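/- For n ≥ 3, the tangent space Hom_{K[x,y,z]}(N_n, K[x,y,z]/N_n)_0 of degree-zero module homomorphisms (with respect to the ℤ^n-grading) has K-dimension 11n - 15. -/

import Mathlib

open MvPolynomial

noncomputable section

variable (K : Type*) [Field K] (n : ℕ)

abbrev R' (K : Type*) [Field K] (n : ℕ) := MvPolynomial (Fin n × Fin 3) K

def Xv (i : Fin n) : R' K n := MvPolynomial.X (i, 0)
def Yv (i : Fin n) : R' K n := MvPolynomial.X (i, 1)
def Zv (i : Fin n) : R' K n := MvPolynomial.X (i, 2)

/-- The monomial ideal `N_n`. -/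
def Nideal : Ideal (R' K n) :=
  Ideal.span ({p | ∃ i k : Fin n, i < k ∧ p = Xv K n i * Yv K n k} ∪
    {p | ∃ i j k : Fin n, i < j ∧ j < k ∧
      (p = Xv K n i * Zv K n j * Xv K n k ∨
       p = Yv K n i * Zv K n j * Yv K n k ∨
       p = Yv K n i * Zv K n j * Xv K n k)})

/-- The weight function giving the `ℤⁿ`-multigrading: each of `x_i, y_i, z_i` has
multidegree `e_i`. -/
def wt : Fin n × Fin 3 → (Fin n →₀ ℕ) := fun p => Finsupp.single p.1 1

/-- A module homomorphism `N_n → R/N_n` has degree zero if it maps every element of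
`N_n` that is homogeneous of multidegree `u` into the image of the multidegree-`u`
component of `R` in `R/N_n`. -/
def IsDeg0 (φ : (Nideal K n) →ₗ[R' K n] (R' K n ⧸ Nideal K n)) : Prop :=
  ∀ (u : Fin n →₀ ℕ) (f : R' K n) (hf : f ∈ Nideal K n),
    f ∈ weightedHomogeneousSubmodule K (wt n) u →
    φ ⟨f, hf⟩ ∈ (weightedHomogeneousSubmodule K (wt n) u).map
      ((Nideal K n).mkQ.restrictScalars K)

/-- The space of degree-zero homomorphisms `N_n → R/N_n`, as a `K`-subspace of
`Hom_R(N_n, R/N_n)`. -/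
def HilbTangentSpace : Submodule K ((Nideal K n) →ₗ[R' K n] (R' K n ⧸ Nideal K n)) where
  carrier := {φ | IsDeg0 K n φ}
  zero_mem' := by
    intro u f hf hhom
    simpa using Submodule.zero_mem _
  add_mem' := by
    intro φ ψ hφ hψ u f hf hhom
    simpa [LinearMap.add_apply] using
      Submodule.add_mem _ (hφ u f hf hhom) (hψ u f hf hhom)
  smul_mem' := by
    intro k φ hφ u f hf hhom
    simpa [LinearMap.smul_apply] using
      Submodule.smul_mem _ k (hφ u f hf hhom)


section helpers

variable {K : Type*} [Field K] {n : ℕ}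

/-- Combinatorial description of the supports of monomials in `N_n`. -/
def InP (P : Fin n × Fin 3 → Prop) : Prop :=
  (∃ i k : Fin n, i < k ∧ P (i, 0) ∧ P (k, 1)) ∨
  (∃ i j k : Fin n, i < j ∧ j < k ∧ (P (i, 0) ∨ P (i, 1)) ∧ P (j, 2) ∧ (P (k, 0) ∨ P (k, 1)))

theorem InP.mono {P Q : Fin n × Fin 3 → Prop} (h : InP P) (hPQ : ∀ v, P v → Q v) : InP Q := by
  rcases h with ⟨i, k, h, h1, h2⟩ | ⟨i, j, k, h, h', h1, h2, h3⟩
  · exact Or.inl ⟨i, k, h, hPQ _ h1, hPQ _ h2⟩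
  · exact Or.inr ⟨i, j, k, h, h', h1.imp (hPQ _) (hPQ _), hPQ _ h2, h3.imp (hPQ _) (hPQ _)⟩

/-- Exponents of monomials in `N_n`. -/
def InN (m : Fin n × Fin 3 →₀ ℕ) : Prop := InP (fun v => 0 < m v)

theorem InN.mono {m m' : Fin n × Fin 3 →₀ ℕ} (h : InN m) (hm : m ≤ m') : InN m' :=
  InP.mono h (fun v hv => lt_of_lt_of_le hv (hm v))

/-- Exponent of a product of variables. -/
def mon (l : List (Fin n × Fin 3)) : Fin n × Fin 3 →₀ ℕ := Multiset.toFinsupp (l : Multiset _)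

theorem mon_apply (l : List (Fin n × Fin 3)) (v) : mon l v = l.count v := by
  rw [mon, Multiset.toFinsupp_apply, Multiset.coe_count]
  congr!

theorem mon_pos (l : List (Fin n × Fin 3)) (v) : 0 < mon l v ↔ v ∈ l := by
  rw [mon_apply]; exact List.count_pos_iff

theorem mon_append (l l' : List (Fin n × Fin 3)) : mon (l ++ l') = mon l + mon l' := by
  ext v; simp [mon_apply]

theorem mon_cons (a) (l : List (Fin n × Fin 3)) : mon (a :: l) = Finsupp.single a 1 + mon l := by
  ext v; simp [mon_apply, List.count_cons, Finsupp.single_apply, add_comm]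

theorem mon_nil : mon ([] : List (Fin n × Fin 3)) = 0 := by
  ext v; simp [mon_apply]

theorem InN_mon (l : List (Fin n × Fin 3)) : InN (mon l) ↔ InP (fun v => v ∈ l) := by
  unfold InN; simp only [mon_pos]

theorem mon_le (p : List (Fin n × Fin 3)) (hp : p.Nodup) (m : Fin n × Fin 3 →₀ ℕ) :
    mon p ≤ m ↔ ∀ w ∈ p, 0 < m w := by
  constructor
  · intro h w hw
    exact lt_of_lt_of_le ((mon_pos p w).2 hw) (h w)
  · intro h w
    rw [mon_apply]
    by_cases hw : w ∈ p
    · rw [List.count_eq_one_of_mem hp hw]; exact h w hw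
    · rw [List.count_eq_zero_of_not_mem hw]; exact Nat.zero_le _

theorem mono_eq (l : List (Fin n × Fin 3)) :
    (monomial (mon l) (1 : K)) = (l.map X).prod := by
  induction l with
  | nil => simp [mon_nil]
  | cons a l ih =>
    rw [mon_cons, List.map_cons, List.prod_cons, ← ih, X, monomial_mul, one_mul]

/-- The list of generators. -/
def IsGen (l : List (Fin n × Fin 3)) : Prop :=
  (∃ i k : Fin n, i < k ∧ l = [(i, 0), (k, 1)]) ∨
  (∃ i j k : Fin n, i < j ∧ j < k ∧
    (l = [(i, 0), (j, 2), (k, 0)] ∨ l = [(i, 1), (j, 2), (k, 1)] ∨ l = [(i, 1), (j, 2), (k, 0)]))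

theorem IsGen.inN {l : List (Fin n × Fin 3)} (h : IsGen l) : InN (mon l) := by
  rw [InN_mon]
  rcases h with ⟨i, k, h, rfl⟩ | ⟨i, j, k, h, h', rfl | rfl | rfl⟩
  · exact Or.inl ⟨i, k, h, by simp, by simp⟩
  all_goals exact Or.inr ⟨i, j, k, h, h', by simp, by simp, by simp⟩

theorem InN_iff (m : Fin n × Fin 3 →₀ ℕ) : InN m ↔ ∃ l, IsGen l ∧ mon l ≤ m := by
  constructor
  · rintro (⟨i, k, h, h1, h2⟩ | ⟨i, j, k, h, h', h1, h2, h3⟩)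
    · refine ⟨[(i, 0), (k, 1)], Or.inl ⟨i, k, h, rfl⟩, ?_⟩
      rw [mon_le _ (by simp)]
      simp [h1, h2]
    · have e1 : i ≠ j := h.ne
      have e2 : j ≠ k := h'.ne
      have e3 : i ≠ k := (h.trans h').ne
      rcases h1 with h1 | h1 <;> rcases h3 with h3 | h3
      · refine ⟨[(i, 0), (j, 2), (k, 0)], Or.inr ⟨i, j, k, h, h', by simp⟩, ?_⟩
        rw [mon_le _ (by simp [e1, e2, e3])]
        simp [h1, h2, h3]
      · refine ⟨[(i, 0), (k, 1)], Or.inl ⟨i, k, h.trans h', rfl⟩, ?_⟩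
        rw [mon_le _ (by simp)]
        simp [h1, h3]
      · refine ⟨[(i, 1), (j, 2), (k, 0)], Or.inr ⟨i, j, k, h, h', by simp⟩, ?_⟩
        rw [mon_le _ (by simp [e1, e2, e3])]
        simp [h1, h2, h3]
      · refine ⟨[(i, 1), (j, 2), (k, 1)], Or.inr ⟨i, j, k, h, h', by simp⟩, ?_⟩
        rw [mon_le _ (by simp [e1, e2, e3])]
        simp [h1, h2, h3]
  · rintro ⟨l, hl, hm⟩
    exact hl.inN.mono hm

theorem Nideal_eq : Nideal K n =
    Ideal.span ((fun s => monomial s (1 : K)) '' {m | ∃ l, IsGen l ∧ mon l = m}) := by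
  unfold Nideal
  congr 1
  ext f
  constructor
  · rintro (⟨i, k, h, rfl⟩ | ⟨i, j, k, h, h', rfl | rfl | rfl⟩)
    · refine ⟨_, ⟨[(i, 0), (k, 1)], Or.inl ⟨i, k, h, rfl⟩, rfl⟩, ?_⟩
      simp [mono_eq, Xv, Yv]
    · refine ⟨_, ⟨[(i, 0), (j, 2), (k, 0)], Or.inr ⟨i, j, k, h, h', by simp⟩, rfl⟩, ?_⟩
      simp [mono_eq, Xv, Zv, mul_assoc]
    · refine ⟨_, ⟨[(i, 1), (j, 2), (k, 1)], Or.inr ⟨i, j, k, h, h', by simp⟩, rfl⟩, ?_⟩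
      simp [mono_eq, Yv, Zv, mul_assoc]
    · refine ⟨_, ⟨[(i, 1), (j, 2), (k, 0)], Or.inr ⟨i, j, k, h, h', by simp⟩, rfl⟩, ?_⟩
      simp [mono_eq, Xv, Yv, Zv, mul_assoc]
  · rintro ⟨_, ⟨l, hl, rfl⟩, rfl⟩
    rcases hl with ⟨i, k, h, rfl⟩ | ⟨i, j, k, h, h', rfl | rfl | rfl⟩
    · exact Or.inl ⟨i, k, h, by simp [mono_eq, Xv, Yv]⟩
    · exact Or.inr ⟨i, j, k, h, h', Or.inl (by simp [mono_eq, Xv, Zv, mul_assoc])⟩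
    · exact Or.inr ⟨i, j, k, h, h', Or.inr (Or.inl (by simp [mono_eq, Yv, Zv, mul_assoc]))⟩
    · exact Or.inr ⟨i, j, k, h, h', Or.inr (Or.inr (by simp [mono_eq, Xv, Yv, Zv, mul_assoc]))⟩

theorem mem_N_iff (f : R' K n) : f ∈ Nideal K n ↔ ∀ m ∈ f.support, InN m := by
  rw [Nideal_eq, mem_ideal_span_monomial_image]
  refine forall₂_congr fun m _ => ?_
  rw [InN_iff]
  constructor
  · rintro ⟨_, ⟨l, hl, rfl⟩, h⟩; exact ⟨l, hl, h⟩
  · rintro ⟨l, hl, h⟩; exact ⟨_, ⟨l, hl, rfl⟩, h⟩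

theorem monomial_mem {m : Fin n × Fin 3 →₀ ℕ} (h : InN m) (a : K) :
    (monomial m a : R' K n) ∈ Nideal K n := by
  rw [mem_N_iff]
  intro m' hm'
  have := support_monomial_subset hm'
  rw [Finset.mem_singleton] at this
  rwa [this]

open Classical in
/-- Coefficient of a standard monomial, as a functional on the quotient. -/
def coefQ (t : Fin n × Fin 3 →₀ ℕ) : (R' K n ⧸ Nideal K n) →ₗ[K] K :=
  if h : InN t then 0 else
  (Submodule.liftQ ((Nideal K n).restrictScalars K) (lcoeff K t) (by
    intro f hf
    rw [LinearMap.mem_ker, lcoeff_apply]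
    by_contra h0
    exact h ((mem_N_iff f).1 hf t (mem_support_iff.2 h0)))) ∘ₗ
    (Submodule.Quotient.restrictScalarsEquiv K (Nideal K n)).symm.toLinearMap

theorem coefQ_mk {t : Fin n × Fin 3 →₀ ℕ} (h : ¬ InN t) (f : R' K n) :
    coefQ t ((Nideal K n).mkQ f) = coeff t f := by
  rw [coefQ, dif_neg h]
  rfl

theorem coefQ_smul {t s : Fin n × Fin 3 →₀ ℕ} (h : ¬ InN (t + s)) (x : R' K n ⧸ Nideal K n) :
    coefQ (t + s) ((monomial s (1 : K) : R' K n) • x) = coefQ t x := by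
  obtain ⟨f, rfl⟩ := (Nideal K n).mkQ_surjective x
  rw [← map_smul, coefQ_mk h, coefQ_mk (fun h' => h (h'.mono le_self_add)), smul_eq_mul,
    mul_comm, coeff_mul_monomial, mul_one]

theorem coefQ_smul_zero {t s : Fin n × Fin 3 →₀ ℕ} (h : ¬ InN t) (hs : ¬ s ≤ t)
    (x : R' K n ⧸ Nideal K n) :
    coefQ t ((monomial s (1 : K) : R' K n) • x) = 0 := by
  obtain ⟨f, rfl⟩ := (Nideal K n).mkQ_surjective x
  rw [← map_smul, coefQ_mk h, smul_eq_mul, coeff_monomial_mul', if_neg hs]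

open Classical in
/-- The coefficient of `t` in the image of the monomial `m`. -/
def cf (m t : Fin n × Fin 3 →₀ ℕ) :
    ((Nideal K n) →ₗ[R' K n] (R' K n ⧸ Nideal K n)) →ₗ[K] K where
  toFun φ := if h : InN m then coefQ t (φ ⟨monomial m 1, monomial_mem h 1⟩) else 0
  map_add' φ ψ := by split_ifs <;> simp
  map_smul' a φ := by split_ifs <;> simp

theorem cf_eq {m : Fin n × Fin 3 →₀ ℕ} (h : InN m) (t) (φ) :
    cf (K := K) m t φ = coefQ t (φ ⟨monomial m 1, monomial_mem h 1⟩) := by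
  simp [cf, h]

theorem cf_mul {m s : Fin n × Fin 3 →₀ ℕ} (h : InN m) (t) (φ) :
    cf (K := K) (m + s) t φ =
      coefQ t ((monomial s (1 : K) : R' K n) • φ ⟨monomial m 1, monomial_mem h 1⟩) := by
  rw [cf_eq (h.mono le_self_add), ← map_smul]
  congr 2
  ext1
  simp [add_comm, monomial_mul]

theorem cf_E {m m' s s' t t' : Fin n × Fin 3 →₀ ℕ} (φ) (hm : InN m) (hm' : InN m')
    (h : ¬ InN (t + s)) (e : m + s = m' + s') (e' : t + s = t' + s') :
    cf (K := K) m t φ = cf m' t' φ := by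
  rw [cf_eq hm, cf_eq hm', ← coefQ_smul h, ← cf_mul hm, e, e', cf_mul hm', coefQ_smul (e' ▸ h)]

theorem cf_Z {m m' s s' t : Fin n × Fin 3 →₀ ℕ} (φ) (hm : InN m) (hm' : InN m')
    (h : ¬ InN (t + s)) (e : m + s = m' + s') (e' : ¬ s' ≤ t + s) :
    cf (K := K) m t φ = 0 := by
  rw [cf_eq hm, ← coefQ_smul h, ← cf_mul hm, e, cf_mul hm', coefQ_smul_zero h e']

theorem not_InN_mon {l : List (Fin n × Fin 3)}
    (h1 : ∀ u ∈ l, u.2 = 0 → ∀ v ∈ l, v.2 = 1 → v.1.1 ≤ u.1.1)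
    (h2 : ∀ v ∈ l, v.2 = 2 → ∀ u ∈ l, u.2 ≠ 2 → u.1.1 < v.1.1 → ∀ w ∈ l, w.2 ≠ 2 → w.1.1 ≤ v.1.1) :
    ¬ InN (mon l) := by
  rw [InN_mon]
  rintro (⟨i, k, h, a1, a2⟩ | ⟨i, j, k, h, h', a1, a2, a3⟩)
  · exact absurd (h1 _ a1 rfl _ a2 rfl) (not_le.2 h)
  · rcases a1 with a1 | a1 <;> rcases a3 with a3 | a3 <;>
    exact absurd (h2 _ a2 rfl _ a1 (by simp) h _ a3 (by simp)) (not_le.2 h')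

theorem gxy {i k : Fin n} (h : i.1 < k.1) : IsGen [(i, 0), (k, 1)] := Or.inl ⟨i, k, h, rfl⟩

theorem gxzx {i j k : Fin n} (h : i.1 < j.1) (h' : j.1 < k.1) : IsGen [(i, 0), (j, 2), (k, 0)] :=
  Or.inr ⟨i, j, k, h, h', Or.inl rfl⟩

theorem gyzy {i j k : Fin n} (h : i.1 < j.1) (h' : j.1 < k.1) : IsGen [(i, 1), (j, 2), (k, 1)] :=
  Or.inr ⟨i, j, k, h, h', Or.inr (Or.inl rfl)⟩

theorem gyzx {i j k : Fin n} (h : i.1 < j.1) (h' : j.1 < k.1) : IsGen [(i, 1), (j, 2), (k, 0)] :=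
  Or.inr ⟨i, j, k, h, h', Or.inr (Or.inr rfl)⟩

/-- Two coefficients agree because of a syzygy. -/
theorem cE {φ} {m t : List (Fin n × Fin 3)} (m' t' s s' : List (Fin n × Fin 3))
    (hm : IsGen m := by
      first | exact gxy (by omega) | exact gxzx (by omega) (by omega) |
        exact gyzy (by omega) (by omega) | exact gyzx (by omega) (by omega))
    (hm' : IsGen m' := by
      first | exact gxy (by omega) | exact gxzx (by omega) (by omega) |
        exact gyzy (by omega) (by omega) | exact gyzx (by omega) (by omega))
    (e : mon m + mon s = mon m' + mon s' := by simp only [mon_cons, mon_nil]; abel)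
    (e' : mon t + mon s = mon t' + mon s' := by simp only [mon_cons, mon_nil]; abel)
    (h : ¬ InN (mon (t ++ s)) := by
      refine not_InN_mon ?_ ?_ <;> simp [-Fin.val_fin_le, -Fin.val_fin_lt] <;> omega) :
    cf (K := K) (mon m) (mon t) φ = cf (mon m') (mon t') φ := by
  rw [mon_append] at h
  exact cf_E φ hm.inN hm'.inN h e e'

/-- A coefficient vanishes because of a syzygy. -/
theorem cZ {φ} {m t : List (Fin n × Fin 3)} (m' s s' : List (Fin n × Fin 3)) (v : Fin n × Fin 3)
    (hm : IsGen m := by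
      first | exact gxy (by omega) | exact gxzx (by omega) (by omega) |
        exact gyzy (by omega) (by omega) | exact gyzx (by omega) (by omega))
    (hm' : IsGen m' := by
      first | exact gxy (by omega) | exact gxzx (by omega) (by omega) |
        exact gyzy (by omega) (by omega) | exact gyzx (by omega) (by omega))
    (e : mon m + mon s = mon m' + mon s' := by simp only [mon_cons, mon_nil]; abel)
    (hv : v ∈ s' := by simp)
    (hv' : v ∉ t ++ s := by simp [Fin.ext_iff] <;> omega)
    (h : ¬ InN (mon (t ++ s)) := by
      refine not_InN_mon ?_ ?_ <;> simp [-Fin.val_fin_le, -Fin.val_fin_lt] <;> omega) :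
    cf (K := K) (mon m) (mon t) φ = 0 := by
  rw [mon_append] at h
  refine cf_Z φ hm.inN hm'.inN h e ?_
  intro hle
  have := lt_of_lt_of_le ((mon_pos s' v).2 hv) (hle v)
  rw [← mon_append, mon_pos] at this
  exact hv' this

theorem not_std {φ} {m t : List (Fin n × Fin 3)} (h : InN (mon t)) :
    cf (K := K) (mon m) (mon t) φ = 0 := by
  by_cases hm : InN (mon m)
  · rw [cf_eq hm, coefQ, dif_pos h]; rfl
  · simp [cf, hm]

/-- The vanishing of the chosen coordinates. -/
structure Van (φ : (Nideal K n) →ₗ[R' K n] (R' K n ⧸ Nideal K n)) : Prop where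
  yy : ∀ i k : Fin n, i.1 + 1 = k.1 → cf (mon [(i, 0), (k, 1)]) (mon [(i, 1), (k, 1)]) φ = 0
  xx : ∀ i k : Fin n, i.1 + 1 = k.1 → cf (mon [(i, 0), (k, 1)]) (mon [(i, 0), (k, 0)]) φ = 0
  zy : ∀ i k : Fin n, i.1 + 1 = k.1 → cf (mon [(i, 0), (k, 1)]) (mon [(i, 2), (k, 1)]) φ = 0
  xz : ∀ i k : Fin n, i.1 + 1 = k.1 → cf (mon [(i, 0), (k, 1)]) (mon [(i, 0), (k, 2)]) φ = 0
  yx : ∀ i k : Fin n, i.1 + 1 = k.1 → cf (mon [(i, 0), (k, 1)]) (mon [(i, 1), (k, 0)]) φ = 0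
  yz : ∀ i k : Fin n, i.1 = 0 → k.1 = 1 → cf (mon [(i, 0), (k, 1)]) (mon [(i, 1), (k, 2)]) φ = 0
  zx : ∀ i k : Fin n, i.1 + 2 = n → k.1 + 1 = n →
    cf (mon [(i, 0), (k, 1)]) (mon [(i, 2), (k, 0)]) φ = 0
  xxx : ∀ i j k : Fin n, i.1 + 1 = j.1 → i.1 + 2 = k.1 →
    cf (mon [(i, 0), (j, 2), (k, 0)]) (mon [(i, 0), (j, 0), (k, 0)]) φ = 0
  xxz : ∀ i j k : Fin n, i.1 + 1 = j.1 → i.1 + 2 = k.1 →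
    cf (mon [(i, 0), (j, 2), (k, 0)]) (mon [(i, 0), (j, 0), (k, 2)]) φ = 0
  xzz : ∀ i j k : Fin n, i.1 + 1 = j.1 → i.1 + 2 = k.1 →
    cf (mon [(i, 0), (j, 2), (k, 0)]) (mon [(i, 0), (j, 2), (k, 2)]) φ = 0
  yyy : ∀ i j k : Fin n, i.1 + 1 = j.1 → i.1 + 2 = k.1 →
    cf (mon [(i, 1), (j, 2), (k, 1)]) (mon [(i, 1), (j, 1), (k, 1)]) φ = 0
  zyy : ∀ i j k : Fin n, i.1 + 1 = j.1 → i.1 + 2 = k.1 →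
    cf (mon [(i, 1), (j, 2), (k, 1)]) (mon [(i, 2), (j, 1), (k, 1)]) φ = 0
  zzy : ∀ i j k : Fin n, i.1 + 1 = j.1 → i.1 + 2 = k.1 →
    cf (mon [(i, 1), (j, 2), (k, 1)]) (mon [(i, 2), (j, 2), (k, 1)]) φ = 0

theorem van_xy {φ : (Nideal K n) →ₗ[R' K n] (R' K n ⧸ Nideal K n)} (hφ : Van φ) (hn : 3 ≤ n)
    (i k : Fin n) (h : i.1 < k.1) (a b : Fin 3) :
    cf (mon [(i, 0), (k, 1)]) (mon [(i, a), (k, b)]) φ = 0 := by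
  have hi := i.2
  have hk := k.2
  obtain ⟨i', hi'⟩ : ∃ i' : Fin n, i'.1 = i.1 + 1 := ⟨⟨i.1 + 1, by omega⟩, rfl⟩
  obtain ⟨k', hk'⟩ : ∃ k' : Fin n, k'.1 + 1 = k.1 := ⟨⟨k.1 - 1, by omega⟩, by simp; omega⟩
  fin_cases a <;> fin_cases b <;> simp only [Fin.zero_eta, Fin.mk_one, Fin.reduceFinMk]
  · -- xx
    rw [cE [(k', 0), (k, 1)] [(k', 0), (k, 0)] [(k', 0)] [(i, 0)]]
    exact hφ.xx _ _ hk'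
  · -- xy
    exact not_std (gxy h).inN
  · -- xz
    rw [cE [(k', 0), (k, 1)] [(k', 0), (k, 2)] [(k', 0)] [(i, 0)]]
    exact hφ.xz _ _ hk'
  · -- yx
    by_cases hik : i.1 + 1 = k.1
    · exact hφ.yx _ _ hik
    · exact cZ [(i, 0), (i', 1)] [(i', 1)] [(k, 1)] (k, 1)
  · -- yy
    rw [cE [(i, 0), (i', 1)] [(i, 1), (i', 1)] [(i', 1)] [(k, 1)]]
    exact hφ.yy _ _ hi'.symm
  · -- yz
    by_cases hik : i.1 + 1 = k.1
    · by_cases hi0 : i.1 = 0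
      · exact hφ.yz _ _ hi0 (by omega)
      · obtain ⟨a, ha⟩ : ∃ a : Fin n, a.1 + 1 = i.1 := ⟨⟨i.1 - 1, by omega⟩, by simp; omega⟩
        exact cZ [(a, 1), (i, 2), (k, 1)] [(a, 1), (i, 2)] [(i, 0)] (i, 0)
    · exact cZ [(i, 0), (i', 1)] [(i', 1)] [(k, 1)] (k, 1)
  · -- zx
    by_cases hik : i.1 + 1 = k.1
    · by_cases hk0 : k.1 + 1 = n
      · exact hφ.zx _ _ (by omega) (by omega)
      · obtain ⟨d, hd⟩ : ∃ d : Fin n, d.1 = k.1 + 1 := ⟨⟨k.1 + 1, by omega⟩, rfl⟩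
        exact cZ [(i, 0), (k, 2), (d, 0)] [(k, 2), (d, 0)] [(k, 1)] (k, 1)
    · exact cZ [(i', 0), (k, 1)] [(i', 0)] [(i, 0)] (i, 0)
  · -- zy
    rw [cE [(i, 0), (i', 1)] [(i, 2), (i', 1)] [(i', 1)] [(k, 1)]]
    exact hφ.zy _ _ hi'.symm
  · -- zz
    by_cases hik : i.1 + 1 = k.1
    · by_cases hi0 : i.1 = 0
      · obtain ⟨d, hd⟩ : ∃ d : Fin n, d.1 = k.1 + 1 := ⟨⟨k.1 + 1, by omega⟩, rfl⟩
        exact cZ [(i, 0), (d, 1)] [(d, 1)] [(k, 1)] (k, 1)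
      · obtain ⟨a, ha⟩ : ∃ a : Fin n, a.1 + 1 = i.1 := ⟨⟨i.1 - 1, by omega⟩, by simp; omega⟩
        exact cZ [(a, 0), (k, 1)] [(a, 0)] [(i, 0)] (i, 0)
    · exact cZ [(i, 0), (i', 1)] [(i', 1)] [(k, 1)] (k, 1)

theorem std3 {i j k : Fin n} (h : i.1 < j.1) (h' : j.1 < k.1) {a b c : Fin 3}
    (hs : ¬ InN (mon [(i, a), (j, b), (k, c)])) :
    ¬ (a = 0 ∧ b = 1) ∧ ¬ (a = 0 ∧ c = 1) ∧ ¬ (b = 0 ∧ c = 1) ∧ ¬ (a ≠ 2 ∧ b = 2 ∧ c ≠ 2) := by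
  rw [InN_mon] at hs
  refine ⟨?_, ?_, ?_, ?_⟩
  · rintro ⟨rfl, rfl⟩
    exact hs (Or.inl ⟨i, j, h, by simp, by simp⟩)
  · rintro ⟨rfl, rfl⟩
    exact hs (Or.inl ⟨i, k, h.trans h', by simp, by simp⟩)
  · rintro ⟨rfl, rfl⟩
    exact hs (Or.inl ⟨j, k, h', by simp, by simp⟩)
  · rintro ⟨ha, rfl, hc⟩
    have ha' : a = 0 ∨ a = 1 := by omega
    have hc' : c = 0 ∨ c = 1 := by omega
    refine hs (Or.inr ⟨i, j, k, h, h', ?_, by simp, ?_⟩)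
    · rcases ha' with rfl | rfl <;> simp
    · rcases hc' with rfl | rfl <;> simp

set_option maxHeartbeats 2000000 in
theorem van_xzx {φ : (Nideal K n) →ₗ[R' K n] (R' K n ⧸ Nideal K n)} (hφ : Van φ) (hn : 3 ≤ n)
    (i j k : Fin n) (h : i.1 < j.1) (h' : j.1 < k.1) (a b c : Fin 3) :
    cf (mon [(i, 0), (j, 2), (k, 0)]) (mon [(i, a), (j, b), (k, c)]) φ = 0 := by
  have hi := i.2
  have hk := k.2
  by_cases hstd : InN (mon [(i, a), (j, b), (k, c)])
  · exact not_std hstd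
  have key := std3 h h' hstd
  clear hstd
  by_cases ha : a = 0
  · subst ha
    have hb : b ≠ 1 := fun h => key.1 ⟨rfl, h⟩
    have hc : c ≠ 1 := fun h => key.2.1 ⟨rfl, h⟩
    by_cases hb2 : b = 2
    · subst hb2
      have hc2 : c = 2 := by
        by_contra hc2
        exact key.2.2.2 ⟨by simp, rfl, hc2⟩
      subst hc2
      obtain ⟨k', hk'⟩ : ∃ k' : Fin n, k'.1 + 1 = k.1 := ⟨⟨k.1 - 1, by omega⟩, by simp; omega⟩
      obtain ⟨k'', hk''⟩ : ∃ k'' : Fin n, k''.1 + 2 = k.1 := ⟨⟨k.1 - 2, by omega⟩, by simp; omega⟩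
      rw [cE [(i, 0), (k', 2), (k, 0)] [(i, 0), (k', 2), (k, 2)] [(k', 2)] [(j, 2)],
        cE [(k'', 0), (k', 2), (k, 0)] [(k'', 0), (k', 2), (k, 2)] [(k'', 0)] [(i, 0)]]
      exact hφ.xzz _ _ _ (by omega) (by omega)
    · have hb0 : b = 0 := by omega
      subst hb0
      obtain ⟨i', hi'⟩ : ∃ i' : Fin n, i'.1 + 1 = j.1 := ⟨⟨j.1 - 1, by omega⟩, by simp; omega⟩
      obtain ⟨k', hk'⟩ : ∃ k' : Fin n, k'.1 = j.1 + 1 := ⟨⟨j.1 + 1, by omega⟩, rfl⟩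
      by_cases hc2 : c = 2
      · subst hc2
        by_cases hjk : j.1 + 1 = k.1
        · rw [cE [(i', 0), (j, 2), (k, 0)] [(i', 0), (j, 0), (k, 2)] [(i', 0)] [(i, 0)]]
          exact hφ.xxz _ _ _ (by omega) (by omega)
        · exact cZ [(i, 0), (k', 2), (k, 0)] [(k', 2)] [(j, 2)] (j, 2)
      · have hc0 : c = 0 := by omega
        subst hc0
        rw [cE [(i', 0), (j, 2), (k', 0)] [(i', 0), (j, 0), (k', 0)] [(i', 0), (k', 0)]
          [(i, 0), (k, 0)]]
        exact hφ.xxx _ _ _ (by omega) (by omega)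
  · by_cases hzzx : a = 2 ∧ b = 2 ∧ c = 0
    · obtain ⟨rfl, rfl, rfl⟩ := hzzx
      rw [cE [(i, 0), (k, 1)] [(i, 2), (k, 1)] [(k, 1)] [(j, 2), (k, 0)]]
      exact van_xy hφ hn i k (h.trans h') _ _
    · replace key := And.intro key (And.intro ha hzzx)
      clear hφ ha hzzx
      fin_cases a <;> fin_cases b <;> fin_cases c <;>
        simp only [Fin.zero_eta, Fin.mk_one, Fin.reduceFinMk] <;>
        first
        | (exfalso; revert key; decide)
        | exact cZ [(i, 0), (j, 1)] [(j, 1)] [(j, 2), (k, 0)] (j, 2)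
        | exact cZ [(i, 0), (j, 1)] [(j, 1)] [(j, 2), (k, 0)] (k, 0)

set_option maxHeartbeats 2000000 in
theorem van_yzy {φ : (Nideal K n) →ₗ[R' K n] (R' K n ⧸ Nideal K n)} (hφ : Van φ) (hn : 3 ≤ n)
    (i j k : Fin n) (h : i.1 < j.1) (h' : j.1 < k.1) (a b c : Fin 3) :
    cf (mon [(i, 1), (j, 2), (k, 1)]) (mon [(i, a), (j, b), (k, c)]) φ = 0 := by
  have hi := i.2
  have hk := k.2
  by_cases hstd : InN (mon [(i, a), (j, b), (k, c)])
  · exact not_std hstd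
  have key := std3 h h' hstd
  clear hstd
  by_cases h1 : a = 1 ∧ b = 1 ∧ c = 1
  · obtain ⟨rfl, rfl, rfl⟩ := h1
    obtain ⟨i', hi'⟩ : ∃ i' : Fin n, i'.1 + 1 = j.1 := ⟨⟨j.1 - 1, by omega⟩, by simp; omega⟩
    obtain ⟨k', hk'⟩ : ∃ k' : Fin n, k'.1 = j.1 + 1 := ⟨⟨j.1 + 1, by omega⟩, rfl⟩
    rw [cE [(i', 1), (j, 2), (k', 1)] [(i', 1), (j, 1), (k', 1)] [(i', 1), (k', 1)]
      [(i, 1), (k, 1)]]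
    exact hφ.yyy _ _ _ (by omega) (by omega)
  by_cases h2 : a = 1 ∧ b = 2 ∧ c = 2
  · obtain ⟨rfl, rfl, rfl⟩ := h2
    rw [cE [(i, 0), (k, 1)] [(i, 0), (k, 2)] [(i, 0)] [(i, 1), (j, 2)]]
    exact van_xy hφ hn i k (h.trans h') _ _
  obtain ⟨i', hi'⟩ : ∃ i' : Fin n, i'.1 = i.1 + 1 := ⟨⟨i.1 + 1, by omega⟩, rfl⟩
  obtain ⟨i'', hi''⟩ : ∃ i'' : Fin n, i''.1 = i.1 + 2 := ⟨⟨i.1 + 2, by omega⟩, rfl⟩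
  by_cases h3 : a = 2 ∧ b = 1 ∧ c = 1
  · obtain ⟨rfl, rfl, rfl⟩ := h3
    by_cases hij : i.1 + 1 = j.1
    · rw [cE [(i, 1), (j, 2), (i'', 1)] [(i, 2), (j, 1), (i'', 1)] [(i'', 1)] [(k, 1)]]
      exact hφ.zyy _ _ _ (by omega) (by omega)
    · exact cZ [(i', 1), (j, 2), (k, 1)] [(i', 1)] [(i, 1)] (i, 1)
  by_cases h4 : a = 2 ∧ b = 2 ∧ c = 1
  · obtain ⟨rfl, rfl, rfl⟩ := h4
    rw [cE [(i, 1), (i', 2), (k, 1)] [(i, 2), (i', 2), (k, 1)] [(i', 2)] [(j, 2)],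
      cE [(i, 1), (i', 2), (i'', 1)] [(i, 2), (i', 2), (i'', 1)] [(i'', 1)] [(k, 1)]]
    exact hφ.zzy _ _ _ (by omega) (by omega)
  replace key := And.intro key (And.intro h1 (And.intro h2 (And.intro h3 h4)))
  clear hφ hi' hi'' i' i'' h1 h2 h3 h4
  fin_cases a <;> fin_cases b <;> fin_cases c <;>
    simp only [Fin.zero_eta, Fin.mk_one, Fin.reduceFinMk] <;>
    first
    | (exfalso; revert key; decide)
    | exact cZ [(i, 0), (k, 1)] [(i, 0)] [(i, 1), (j, 2)] (j, 2)
    | exact cZ [(i, 0), (k, 1)] [(i, 0)] [(i, 1), (j, 2)] (i, 1)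
    | exact cZ [(j, 0), (k, 1)] [(j, 0)] [(i, 1), (j, 2)] (j, 2)
    | exact cZ [(j, 0), (k, 1)] [(j, 0)] [(i, 1), (j, 2)] (i, 1)

set_option maxHeartbeats 2000000 in
theorem van_yzx {φ : (Nideal K n) →ₗ[R' K n] (R' K n ⧸ Nideal K n)} (hφ : Van φ) (hn : 3 ≤ n)
    (i j k : Fin n) (h : i.1 < j.1) (h' : j.1 < k.1) (a b c : Fin 3) :
    cf (mon [(i, 1), (j, 2), (k, 0)]) (mon [(i, a), (j, b), (k, c)]) φ = 0 := by
  have hi := i.2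
  have hk := k.2
  by_cases hstd : InN (mon [(i, a), (j, b), (k, c)])
  · exact not_std hstd
  have key := std3 h h' hstd
  clear hstd
  have hx := van_xzx hφ hn i j k h h'
  have hy := van_yzy hφ hn i j k h h'
  have hE1 : a = 1 → ¬ InN (mon ([(i, a), (j, b), (k, c)] ++ [(i, 0)])) →
      cf (mon [(i, 1), (j, 2), (k, 0)]) (mon [(i, a), (j, b), (k, c)]) φ = 0 := by
    rintro rfl hs
    rw [cE [(i, 0), (j, 2), (k, 0)] [(i, 0), (j, b), (k, c)] [(i, 0)] [(i, 1)] (h := hs)]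
    exact hx _ _ _
  have hE2 : c = 0 → ¬ InN (mon ([(i, a), (j, b), (k, c)] ++ [(k, 1)])) →
      cf (mon [(i, 1), (j, 2), (k, 0)]) (mon [(i, a), (j, b), (k, c)]) φ = 0 := by
    rintro rfl hs
    rw [cE [(i, 1), (j, 2), (k, 1)] [(i, a), (j, b), (k, 1)] [(k, 1)] [(k, 0)] (h := hs)]
    exact hy _ _ _
  clear hφ hx hy
  fin_cases a <;> fin_cases b <;> fin_cases c <;>
    simp only [Fin.zero_eta, Fin.mk_one, Fin.reduceFinMk] <;>
    first
    | (exfalso; revert key; decide)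
    | exact cZ [(i, 0), (j, 2), (k, 0)] [(i, 0)] [(i, 1)] (i, 1)
    | exact cZ [(i, 1), (j, 2), (k, 1)] [(k, 1)] [(k, 0)] (k, 0)
    | (refine hE1 rfl (not_InN_mon ?_ ?_) <;> simp [-Fin.val_fin_le, -Fin.val_fin_lt] <;> omega)
    | (refine hE2 rfl (not_InN_mon ?_ ?_) <;> simp [-Fin.val_fin_le, -Fin.val_fin_lt] <;> omega)

theorem weight_split (t : Fin n × Fin 3 →₀ ℕ) (i : Fin n) (u : Fin n →₀ ℕ)
    (h : Finsupp.weight (wt n) t = Finsupp.single i 1 + u) :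
    ∃ a t', t = Finsupp.single (i, a) 1 + t' ∧ Finsupp.weight (wt n) t' = u := by
  have h1 : (Finsupp.weight (wt n) t) i ≠ 0 := by rw [h]; simp
  rw [Finsupp.weight_apply, Finsupp.sum, Finsupp.finsetSum_apply] at h1
  obtain ⟨⟨j, a⟩, hv, hne⟩ := Finset.exists_ne_zero_of_sum_ne_zero h1
  have hj : j = i := by
    by_contra hji
    apply hne
    simp [wt, hji]
  subst hj
  have hle : Finsupp.single (j, a) 1 ≤ t := by
    rw [Finsupp.single_le_iff]
    exact Nat.one_le_iff_ne_zero.2 (Finsupp.mem_support_iff.1 hv)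
  refine ⟨a, t - Finsupp.single (j, a) 1, (add_tsub_cancel_of_le hle).symm, ?_⟩
  have h2 := congrArg (Finsupp.weight (wt n)) (add_tsub_cancel_of_le hle)
  rw [h, map_add, Finsupp.weight_single] at h2
  simpa [wt] using h2

theorem weight_zero (t : Fin n × Fin 3 →₀ ℕ) (h : Finsupp.weight (wt n) t = 0) : t = 0 := by
  ext ⟨i, a⟩
  by_contra hne
  have hle : Finsupp.single (i, a) 1 ≤ t := by
    rw [Finsupp.single_le_iff]
    exact Nat.one_le_iff_ne_zero.2 hne
  have h2 := congrArg (Finsupp.weight (wt n)) (add_tsub_cancel_of_le hle)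
  rw [h, map_add, Finsupp.weight_single] at h2
  have := DFunLike.congr_fun h2 i
  simp [wt] at this

theorem weight_mon (l : List (Fin n × Fin 3)) :
    Finsupp.weight (wt n) (mon l) = (l.map (fun v => Finsupp.single v.1 1)).sum := by
  induction l with
  | nil => simp [mon_nil]
  | cons a l ih => simp [mon_cons, Finsupp.weight_single, ih, wt]

theorem phi_gen_zero {φ : (Nideal K n) →ₗ[R' K n] (R' K n ⧸ Nideal K n)}
    (hφ : φ ∈ HilbTangentSpace K n) (l : List (Fin n × Fin 3)) (hl : InN (mon l))
    (h : ∀ t, Finsupp.weight (wt n) t = Finsupp.weight (wt n) (mon l) → cf (mon l) t φ = 0) :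
    φ ⟨monomial (mon l) 1, monomial_mem hl 1⟩ = 0 := by
  obtain ⟨f, hf, hfe⟩ := hφ (Finsupp.weight (wt n) (mon l)) (monomial (mon l) 1)
    (monomial_mem hl 1) (isWeightedHomogeneous_monomial _ _ _ rfl)
  rw [← hfe]
  change (Nideal K n).mkQ f = 0
  rw [Submodule.mkQ_apply, Submodule.Quotient.mk_eq_zero, mem_N_iff]
  intro t ht
  by_contra hN
  have h1 := h t (hf (mem_support_iff.1 ht))
  rw [cf_eq hl, ← hfe] at h1
  change coefQ t ((Nideal K n).mkQ f) = 0 at h1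
  rw [coefQ_mk hN] at h1
  exact mem_support_iff.1 ht h1

theorem phi_zero {φ : (Nideal K n) →ₗ[R' K n] (R' K n ⧸ Nideal K n)}
    (hT : φ ∈ HilbTangentSpace K n) (hφ : Van φ) (hn : 3 ≤ n) : φ = 0 := by
  have hgen : ∀ l, ∀ hl : IsGen l, φ ⟨monomial (mon l) 1, monomial_mem hl.inN 1⟩ = 0 := by
    intro l hl
    refine phi_gen_zero hT l hl.inN ?_
    intro t ht
    rw [weight_mon] at ht
    rcases hl with ⟨i, k, h, rfl⟩ | ⟨i, j, k, h, h', rfl | rfl | rfl⟩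
    · simp only [List.map_cons, List.map_nil, List.sum_cons, List.sum_nil] at ht
      obtain ⟨a, t1, rfl, ht1⟩ := weight_split _ _ _ ht
      obtain ⟨b, t2, rfl, ht2⟩ := weight_split _ _ _ ht1
      rw [weight_zero _ ht2]
      have := van_xy hφ hn i k h a b
      simpa [mon_cons, mon_nil] using this
    all_goals
      simp only [List.map_cons, List.map_nil, List.sum_cons, List.sum_nil] at ht
      obtain ⟨a, t1, rfl, ht1⟩ := weight_split _ _ _ ht
      obtain ⟨b, t2, rfl, ht2⟩ := weight_split _ _ _ ht1
      obtain ⟨c, t3, rfl, ht3⟩ := weight_split _ _ _ ht2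
      rw [weight_zero _ ht3]
    · have := van_xzx hφ hn i j k h h' a b c
      simpa [mon_cons, mon_nil] using this
    · have := van_yzy hφ hn i j k h h' a b c
      simpa [mon_cons, mon_nil] using this
    · have := van_yzx hφ hn i j k h h' a b c
      simpa [mon_cons, mon_nil] using this
  have hall : ∀ f (hf : f ∈ Ideal.span ((fun s => monomial s (1 : K)) ''
      {m : Fin n × Fin 3 →₀ ℕ | ∃ l, IsGen l ∧ mon l = m})),
      φ ⟨f, Nideal_eq (K := K) (n := n) ▸ hf⟩ = 0 := by
    intro f hf
    induction hf using Submodule.span_induction with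
    | mem x hx =>
      obtain ⟨_, ⟨l, hl, rfl⟩, rfl⟩ := hx
      exact hgen l hl
    | zero => exact map_zero φ
    | add x y hx hy h1 h2 =>
      have := map_add φ ⟨x, Nideal_eq (K := K) (n := n) ▸ hx⟩ ⟨y, Nideal_eq (K := K) (n := n) ▸ hy⟩
      rw [h1, h2, add_zero] at this
      exact this
    | smul r x hx h1 =>
      have := map_smul φ r ⟨x, Nideal_eq (K := K) (n := n) ▸ hx⟩
      rw [h1, smul_zero] at this
      exact this
  ext ⟨f, hf⟩
  exact hall f (Nideal_eq (K := K) (n := n) ▸ hf)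

open Classical in
/-- The `K`-linear map sending a monomial `m` with `p ≤ m` and `E m` to `m - p + q`. -/
def psi (p q : Fin n × Fin 3 →₀ ℕ) (E : (Fin n × Fin 3 →₀ ℕ) → Prop) :
    R' K n →ₗ[K] (R' K n ⧸ Nideal K n) :=
  (basisMonomials (Fin n × Fin 3) K).constr K
    (fun m => if p ≤ m ∧ E m then (Nideal K n).mkQ (monomial (m - p + q) 1) else 0)

open Classical in
theorem psi_monomial (p q : Fin n × Fin 3 →₀ ℕ) (E) (m) :
    psi (K := K) p q E (monomial m 1) =
      if p ≤ m ∧ E m then (Nideal K n).mkQ (monomial (m - p + q) 1) else 0 := by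
  have := (basisMonomials (Fin n × Fin 3) K).constr_basis K
    (fun m => if p ≤ m ∧ E m then (Nideal K n).mkQ (monomial (m - p + q) (1 : K)) else 0) m
  rwa [coe_basisMonomials] at this

/-- Compatibility condition making `psi` linear on `N_n`. -/
def Good (p q : Fin n × Fin 3 →₀ ℕ) (E : (Fin n × Fin 3 →₀ ℕ) → Prop) : Prop :=
  ∀ m v, InN m → p ≤ m + Finsupp.single v 1 →
    ¬ ((p ≤ m ∧ E m) ∧ E (m + Finsupp.single v 1)) →
    ((p ≤ m ∧ E m) ∨ E (m + Finsupp.single v 1)) → InN (m + Finsupp.single v 1 - p + q)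

theorem mkQ_monomial_zero {m : Fin n × Fin 3 →₀ ℕ} (h : InN m) :
    (Nideal K n).mkQ (monomial m (1 : K)) = 0 := by
  rw [Submodule.mkQ_apply, Submodule.Quotient.mk_eq_zero]
  exact monomial_mem h 1

theorem psi_X_mul_monomial {p q : Fin n × Fin 3 →₀ ℕ} {E} (hG : Good p q E) {m} (hm : InN m) (v) :
    psi (K := K) p q E (X v * monomial m 1) = (X v : R' K n) • psi p q E (monomial m 1) := by
  have e : (X v * monomial m 1 : R' K n) = monomial (m + Finsupp.single v 1) 1 := by
    rw [X, monomial_mul, one_mul, add_comm]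
  rw [e, psi_monomial, psi_monomial]
  by_cases h1 : p ≤ m ∧ E m
  · have hle : p ≤ m + Finsupp.single v 1 := h1.1.trans le_self_add
    have e2 : (X v : R' K n) • (Nideal K n).mkQ (monomial (m - p + q) (1 : K)) =
        (Nideal K n).mkQ (monomial (m + Finsupp.single v 1 - p + q) 1) := by
      rw [← map_smul, smul_eq_mul, X, monomial_mul, one_mul, ← tsub_add_eq_add_tsub h1.1,
        ← add_assoc, add_comm (Finsupp.single v 1) (m - p)]
    rw [if_pos h1, e2]
    by_cases h2 : E (m + Finsupp.single v 1)
    · rw [if_pos ⟨hle, h2⟩]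
    · rw [if_neg (fun h => h2 h.2), mkQ_monomial_zero (hG m v hm hle (fun h => h2 h.2) (Or.inl h1))]
  · rw [if_neg h1, smul_zero]
    split_ifs with h2
    · exact mkQ_monomial_zero (hG m v hm h2.1 (fun h => h1 h.1) (Or.inr h2.2))
    · rfl

theorem psi_X_mul {p q : Fin n × Fin 3 →₀ ℕ} {E} (hG : Good p q E) (v) {f : R' K n}
    (hf : f ∈ Nideal K n) :
    psi (K := K) p q E (X v * f) = (X v : R' K n) • psi p q E f := by
  rw [f.as_sum, Finset.mul_sum, map_sum, map_sum, Finset.smul_sum]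
  refine Finset.sum_congr rfl fun m hm => ?_
  have hm' := (mem_N_iff f).1 hf m hm
  have e : (monomial m (coeff m f) : R' K n) = coeff m f • monomial m 1 := by
    rw [smul_monomial, smul_eq_mul, mul_one]
  rw [e, mul_smul_comm, map_smul, map_smul, psi_X_mul_monomial hG hm', smul_comm]

theorem psi_mul {p q : Fin n × Fin 3 →₀ ℕ} {E} (hG : Good p q E) (r : R' K n) :
    ∀ f ∈ Nideal K n, psi (K := K) p q E (r * f) = r • psi p q E f := by
  induction r using MvPolynomial.induction_on with
  | C a =>
    intro f _
    rw [← smul_eq_C_mul, map_smul]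
    exact (algebraMap_smul (R' K n) a _).symm
  | add r s hr hs =>
    intro f hf
    rw [add_mul, map_add, hr f hf, hs f hf, add_smul]
  | mul_X r v hr =>
    intro f hf
    rw [mul_assoc, hr _ (Ideal.mul_mem_left _ _ hf), psi_X_mul hG v hf, mul_smul]

/-- The homomorphism given by `psi`. -/
def psiHom {p q : Fin n × Fin 3 →₀ ℕ} {E} (hG : Good p q E) :
    (Nideal K n) →ₗ[R' K n] (R' K n ⧸ Nideal K n) where
  toFun f := psi p q E f.1
  map_add' f g := by simp
  map_smul' r f := by
    simpa using psi_mul hG r f.1 f.2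

theorem psiHom_mem {p q : Fin n × Fin 3 →₀ ℕ} {E} (hG : Good p q E)
    (hw : Finsupp.weight (wt n) p = Finsupp.weight (wt n) q) :
    psiHom (K := K) hG ∈ HilbTangentSpace K n := by
  intro u f hf hu
  change psi p q E f ∈ _
  rw [f.as_sum, map_sum]
  refine Submodule.sum_mem _ fun m hm => ?_
  have e : (monomial m (coeff m f) : R' K n) = coeff m f • monomial m 1 := by
    rw [smul_monomial, smul_eq_mul, mul_one]
  rw [e, map_smul]
  refine Submodule.smul_mem _ _ ?_
  rw [psi_monomial]
  split_ifs with h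
  · refine ⟨monomial (m - p + q) 1, ?_, rfl⟩
    apply isWeightedHomogeneous_monomial
    rw [map_add, ← hw, ← map_add, tsub_add_cancel_of_le h.1]
    exact hu (mem_support_iff.1 hm)
  · exact Submodule.zero_mem _

open Classical in
theorem cf_psiHom {p q : Fin n × Fin 3 →₀ ℕ} {E} (hG : Good p q E) {m t} (hm : InN m)
    (ht : ¬ InN t) :
    cf m t (psiHom (K := K) hG) = if p ≤ m ∧ E m ∧ m + q = t + p then 1 else 0 := by
  rw [cf_eq hm]
  change coefQ t (psi p q E (monomial m 1)) = _
  rw [psi_monomial]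
  by_cases h : p ≤ m ∧ E m
  · rw [if_pos h, coefQ_mk ht, coeff_monomial]
    have : m - p + q = t ↔ m + q = t + p := by
      rw [tsub_add_eq_add_tsub h.1, tsub_eq_iff_eq_add_of_le (h.1.trans le_self_add)]
    simp only [this, h.1, h.2, true_and]
  · rw [if_neg h, if_neg (fun h' => h ⟨h'.1, h'.2.1⟩), map_zero]

theorem InN_shift {m : Fin n × Fin 3 →₀ ℕ} {p q : List (Fin n × Fin 3)}
    (h : InP (fun w => (0 < m w ∧ w ∉ p) ∨ w ∈ q)) : InN (m - mon p + mon q) := by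
  refine InP.mono h ?_
  rintro w (⟨h1, h2⟩ | h2)
  · have : mon p w = 0 := by rw [mon_apply, List.count_eq_zero_of_not_mem h2]
    simp only [Finsupp.add_apply, Finsupp.tsub_apply, this]
    omega
  · have := (mon_pos q w).2 h2
    simp only [Finsupp.add_apply, Finsupp.tsub_apply]
    omega

theorem good_full {p q : List (Fin n × Fin 3)} (hp : p.Nodup)
    (H : ∀ P : Fin n × Fin 3 → Prop, InP P → (∃ w ∈ p, ¬ P w) →
      InP (fun w => (P w ∧ w ∉ p) ∨ w ∈ q)) :
    Good (mon p) (mon q) (fun _ => True) := by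
  intro m v hm hle h1 _
  rw [mon_le p hp m] at h1
  apply InN_shift
  refine InP.mono (H (fun w => 0 < m w) hm ?_) ?_
  · by_contra hc
    push Not at hc
    exact h1 ⟨⟨fun w hw => hc w hw, trivial⟩, trivial⟩
  · rintro w (⟨h2, h3⟩ | h2)
    · exact Or.inl ⟨lt_of_lt_of_le h2 (by simp), h3⟩
    · exact Or.inr h2

theorem good_single (w w' : Fin n × Fin 3) : Good (mon [w]) (mon [w']) (fun _ => True) := by
  refine good_full (by simp) ?_
  rintro P hP ⟨u, hu, hPu⟩
  rw [List.mem_singleton] at hu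
  subst hu
  refine InP.mono hP fun v hv => Or.inl ⟨hv, ?_⟩
  rw [List.mem_singleton]
  rintro rfl
  exact hPu hv

/-- Some `x` or `y` variable with smaller index occurs. -/
def bef (i : Fin n) (m : Fin n × Fin 3 →₀ ℕ) : Prop :=
  ∃ a, a < i ∧ (0 < m (a, 0) ∨ 0 < m (a, 1))

theorem good_bef_aux (i : Fin n) (o : Fin 3) {m v} (hm : InN m)
    (h1 : ¬ bef i m) (h2 : bef i (m + Finsupp.single v 1)) :
    InN (m + Finsupp.single v 1 - mon [(i, o)] + mon [(i, 2)]) := by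
  apply InN_shift
  obtain ⟨a, ha, h2⟩ := h2
  have hk : ∃ k, i < k ∧ (0 < m (k, 0) ∨ 0 < m (k, 1)) := by
    rcases hm with ⟨i', k, h, a1, a2⟩ | ⟨i', j, k, h, h', a1, a2, a3⟩
    · refine ⟨k, ?_, Or.inr a2⟩
      by_contra hc
      exact h1 ⟨i', lt_of_lt_of_le h (not_lt.1 hc), Or.inl a1⟩
    · refine ⟨k, ?_, a3⟩
      by_contra hc
      exact h1 ⟨i', lt_of_lt_of_le (h.trans h') (not_lt.1 hc), a1⟩
  obtain ⟨k, hik, hk⟩ := hk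
  refine Or.inr ⟨a, i, k, ha, hik, ?_, Or.inr (by simp), ?_⟩
  · rcases h2 with h2 | h2
    · exact Or.inl (Or.inl ⟨h2, by simp [ha.ne]⟩)
    · exact Or.inr (Or.inl ⟨h2, by simp [ha.ne]⟩)
  · rcases hk with h2 | h2
    · exact Or.inl (Or.inl ⟨lt_of_lt_of_le h2 (by simp), by simp [hik.ne']⟩)
    · exact Or.inr (Or.inl ⟨lt_of_lt_of_le h2 (by simp), by simp [hik.ne']⟩)

theorem bef_mono (i : Fin n) {m m' : Fin n × Fin 3 →₀ ℕ} (h : m ≤ m') (hb : bef i m) : bef i m' := by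
  obtain ⟨a, ha, hb⟩ := hb
  exact ⟨a, ha, hb.imp (fun x => lt_of_lt_of_le x (h _)) (fun x => lt_of_lt_of_le x (h _))⟩

theorem good_bef (i : Fin n) (o : Fin 3) : Good (mon [(i, o)]) (mon [(i, 2)]) (bef i) := by
  intro m v hm hle h1 h2
  by_cases hp : mon [(i, o)] ≤ m
  · have hb := bef_mono i (m := m) (m' := m + Finsupp.single v 1) le_self_add
    apply good_bef_aux i o hm <;> tauto
  · exact good_single _ _ m v hm hle (fun h => hp h.1.1) (Or.inr trivial)

theorem good_nbef (i : Fin n) (o : Fin 3) :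
    Good (mon [(i, o)]) (mon [(i, 2)]) (fun m => ¬ bef i m) := by
  intro m v hm hle h1 h2
  by_cases hp : mon [(i, o)] ≤ m
  · have hb := bef_mono i (m := m) (m' := m + Finsupp.single v 1) le_self_add
    apply good_bef_aux i o hm <;> tauto
  · exact good_single _ _ m v hm hle (fun h => hp h.1.1) (Or.inr trivial)

theorem InP_of {Q : Fin n × Fin 3 → Prop}
    (h : (∀ a b : Fin n, a.1 < b.1 → Q (a, 0) → Q (b, 1) → False) →
      (∀ a c b : Fin n, a.1 < c.1 → c.1 < b.1 → (Q (a, 0) ∨ Q (a, 1)) → Q (c, 2) →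
        (Q (b, 0) ∨ Q (b, 1)) → False) → False) : InP Q := by
  by_contra hc
  exact h (fun a b h1 h2 h3 => hc (Or.inl ⟨a, b, h1, h2, h3⟩))
    (fun a c b h1 h2 h3 h4 h5 => hc (Or.inr ⟨a, c, b, h1, h2, h3, h4, h5⟩))

theorem good_D1 (i k : Fin n) (h : i.1 + 1 = k.1) :
    Good (mon [(i, 0), (k, 1)]) (mon [(i, 1), (k, 0)]) (fun _ => True) := by
  refine good_full (by simp) ?_
  intro P hP hw
  apply InP_of
  intro h1 h2
  have f1 : ∀ a : Fin n, a < k → a = i ∨ a < i := by intro a ha; rw [Fin.ext_iff]; omega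
  have f2 : ∀ a : Fin n, i < a → a = k ∨ k < a := by intro a ha; rw [Fin.ext_iff]; omega
  have f3 : i < k := by omega
  simp at h1 h2 hw
  rcases hP with ⟨i', k', h, a1, a2⟩ | ⟨i', j', k', h, h', a1, a2, a3⟩ <;> grind

theorem good_D2 (i k : Fin n) (h : i.1 + 1 = k.1) :
    Good (mon [(i, 1), (k, 2)]) (mon [(i, 2), (k, 1)]) (fun _ => True) := by
  refine good_full (by simp) ?_
  intro P hP hw
  apply InP_of
  intro h1 h2
  have f1 : ∀ a : Fin n, a < k → a = i ∨ a < i := by intro a ha; rw [Fin.ext_iff]; omega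
  have f2 : ∀ a : Fin n, i < a → a = k ∨ k < a := by intro a ha; rw [Fin.ext_iff]; omega
  have f3 : i < k := by omega
  simp at h1 h2 hw
  rcases hP with ⟨i', k', h, a1, a2⟩ | ⟨i', j', k', h, h', a1, a2, a3⟩ <;> grind

theorem good_D2' (i k : Fin n) (h : i.1 + 1 = k.1) :
    Good (mon [(i, 2), (k, 0)]) (mon [(i, 0), (k, 2)]) (fun _ => True) := by
  refine good_full (by simp) ?_
  intro P hP hw
  apply InP_of
  intro h1 h2
  have f1 : ∀ a : Fin n, a < k → a = i ∨ a < i := by intro a ha; rw [Fin.ext_iff]; omega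
  have f2 : ∀ a : Fin n, i < a → a = k ∨ k < a := by intro a ha; rw [Fin.ext_iff]; omega
  have f3 : i < k := by omega
  simp at h1 h2 hw
  rcases hP with ⟨i', k', h, a1, a2⟩ | ⟨i', j', k', h, h', a1, a2, a3⟩ <;> grind

theorem good_D3 (i k : Fin n) (h : i.1 = 0) (hk : k.1 = 1) :
    Good (mon [(i, 0), (k, 1)]) (mon [(i, 1), (k, 2)]) (fun _ => True) := by
  refine good_full (by simp) ?_
  intro P hP hw
  apply InP_of
  intro h1 h2
  have f1 : ∀ a : Fin n, a < k → a = i ∨ a < i := by intro a ha; rw [Fin.ext_iff]; omega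
  have f2 : ∀ a : Fin n, i < a → a = k ∨ k < a := by intro a ha; rw [Fin.ext_iff]; omega
  have f3 : i < k := by omega
  simp at h1 h2 hw
  rcases hP with ⟨i', k', h, a1, a2⟩ | ⟨i', j', k', h, h', a1, a2, a3⟩ <;> grind

theorem good_D3' (i k : Fin n) (h : i.1 + 2 = n) (hk : k.1 + 1 = n) :
    Good (mon [(i, 0), (k, 1)]) (mon [(i, 2), (k, 0)]) (fun _ => True) := by
  refine good_full (by simp) ?_
  intro P hP hw
  apply InP_of
  intro h1 h2
  have f1 : ∀ a : Fin n, a < k → a = i ∨ a < i := by intro a ha; rw [Fin.ext_iff]; omega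
  have f2 : ∀ a : Fin n, i < a → a = k ∨ k < a := by intro a ha; rw [Fin.ext_iff]; omega
  have f3 : i < k := by omega
  simp at h1 h2 hw
  rcases hP with ⟨i', k', h, a1, a2⟩ | ⟨i', j', k', h, h', a1, a2, a3⟩ <;> grind

/-- Index set of the basis. -/
abbrev IB (n : ℕ) := (Fin 5 × Fin (n - 1)) ⊕ (Fin 6 × Fin (n - 2)) ⊕ Fin 2

def nd (n a : ℕ) (h : a < n) : Fin n := ⟨a, h⟩

theorem nd_val (n a : ℕ) (h : a < n) : (nd n a h).1 = a := rfl

theorem nd_inj (n a b : ℕ) (h : a < n) (h' : b < n) : nd n a h = nd n b h' ↔ a = b := by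
  simp [nd]

theorem nd_lt (n a : ℕ) (h : a < n) (x : Fin n) : x < nd n a h ↔ x.1 < a := Iff.rfl

def gB (hn : 3 ≤ n) : IB n → List (Fin n × Fin 3)
  | .inl (_, i) => [(nd n i.1 (by omega), 0), (nd n (i.1 + 1) (by omega), 1)]
  | .inr (.inl (c, i)) => [(nd n i.1 (by omega), ![0, 0, 0, 1, 1, 1] c),
      (nd n (i.1 + 1) (by omega), 2), (nd n (i.1 + 2) (by omega), ![0, 0, 0, 1, 1, 1] c)]
  | .inr (.inr e) => [(nd n (if e = 0 then 0 else n - 2) (by split_ifs <;> omega), 0),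
      (nd n (if e = 0 then 1 else n - 1) (by split_ifs <;> omega), 1)]

def tB (hn : 3 ≤ n) : IB n → List (Fin n × Fin 3)
  | .inl (c, i) => [(nd n i.1 (by omega), ![1, 0, 2, 0, 1] c),
      (nd n (i.1 + 1) (by omega), ![1, 0, 1, 2, 0] c)]
  | .inr (.inl (c, i)) => [(nd n i.1 (by omega), ![0, 0, 0, 1, 2, 2] c),
      (nd n (i.1 + 1) (by omega), ![0, 0, 2, 1, 1, 2] c),
      (nd n (i.1 + 2) (by omega), ![0, 2, 2, 1, 1, 1] c)]
  | .inr (.inr e) => [(nd n (if e = 0 then 0 else n - 2) (by split_ifs <;> omega), ![1, 2] e),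
      (nd n (if e = 0 then 1 else n - 1) (by split_ifs <;> omega), ![2, 0] e)]

theorem gB_gen (hn : 3 ≤ n) (b : IB n) : IsGen (gB hn b) := by
  rcases b with ⟨c, i⟩ | ⟨c, i⟩ | e
  · exact gxy (by simp [nd_val])
  · fin_cases c
    all_goals first
      | exact gxzx (by simp [nd_val]) (by simp [nd_val])
      | exact gyzy (by simp [nd_val]) (by simp [nd_val])
  · refine gxy ?_
    fin_cases e <;> simp [nd_val]
    omega

theorem tB_std (hn : 3 ≤ n) (b : IB n) : ¬ InN (mon (tB hn b)) := by
  rcases b with ⟨c, i⟩ | ⟨c, i⟩ | e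
  · fin_cases c <;> refine not_InN_mon ?_ ?_ <;>
      simp [-Fin.val_fin_le, -Fin.val_fin_lt, tB, nd_val] <;> omega
  · fin_cases c <;> refine not_InN_mon ?_ ?_ <;>
      simp [-Fin.val_fin_le, -Fin.val_fin_lt, tB, nd_val] <;> omega
  · fin_cases e <;> refine not_InN_mon ?_ ?_ <;>
      simp [-Fin.val_fin_le, -Fin.val_fin_lt, tB, nd_val] <;> omega

theorem dual_aux (hn : 3 ≤ n) (b : IB n) {p q : List (Fin n × Fin 3)} {E}
    (hG : Good (mon p) (mon q) E)
    (hw : p.map Prod.fst = q.map Prod.fst)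
    (h1 : mon p ≤ mon (gB hn b)) (h2 : E (mon (gB hn b)))
    (h3 : mon (gB hn b) + mon q = mon (tB hn b) + mon p)
    (hf : ∀ b', (∀ w ∈ p, w ∈ gB hn b') → E (mon (gB hn b')) →
      (∀ w ∈ q, w ∈ tB hn b' ∨ w ∈ p) → (∀ w ∈ tB hn b', w ∈ gB hn b' ∨ w ∈ q) → b' = b) :
    ∃ φ ∈ HilbTangentSpace K n, ∀ b', cf (mon (gB hn b')) (mon (tB hn b')) φ =
      if b' = b then 1 else 0 := by
  refine ⟨psiHom hG, psiHom_mem hG ?_, fun b' => ?_⟩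
  · rw [weight_mon, weight_mon]
    have : ∀ l : List (Fin n × Fin 3), l.map (fun v => Finsupp.single v.1 1) =
        (l.map Prod.fst).map (fun v => (Finsupp.single v 1 : Fin n →₀ ℕ)) := by
      intro l; simp
    rw [this, this, hw]
  · rw [cf_psiHom hG (gB_gen hn b').inN (tB_std hn b')]
    congr 1
    refine propext ⟨?_, ?_⟩
    · rintro ⟨a1, a2, a3⟩
      rw [← mon_append, ← mon_append] at a3
      have a4 : ∀ w, w ∈ gB hn b' ++ q ↔ w ∈ tB hn b' ++ p := by
        intro w
        rw [← mon_pos, ← mon_pos, a3]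
      simp only [List.mem_append] at a4
      refine hf b' (fun w hw => ?_) a2 (fun w hw => (a4 w).1 (Or.inr hw))
        (fun w hw => (a4 w).2 (Or.inl hw))
      exact (mon_pos _ _).1 (lt_of_lt_of_le ((mon_pos p w).2 hw) (a1 w))
    · rintro rfl
      exact ⟨h1, h2, h3⟩

theorem bef_mon (i : Fin n) (l : List (Fin n × Fin 3)) :
    bef i (mon l) ↔ ∃ v ∈ l, v.1 < i ∧ v.2 ≠ 2 := by
  unfold bef
  simp only [mon_pos]
  constructor
  · rintro ⟨a, h, h' | h'⟩
    · exact ⟨_, h', h, by simp⟩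
    · exact ⟨_, h', h, by simp⟩
  · rintro ⟨⟨a, o⟩, h, h1, h2⟩
    refine ⟨a, h1, ?_⟩
    fin_cases o
    · exact Or.inl h
    · exact Or.inr h
    · exact absurd rfl h2

set_option maxHeartbeats 2000000 in
theorem dual_pair (hn : 3 ≤ n) (d : Fin 5 × Fin (n - 1)) :
    ∃ φ ∈ HilbTangentSpace K n, ∀ b', cf (mon (gB hn b')) (mon (tB hn b')) φ =
      if b' = .inl d then 1 else 0 := by
  obtain ⟨c, i⟩ := d
  fin_cases c
  · refine dual_aux hn _ (good_single (nd n i.1 (by omega), 0) (nd n i.1 (by omega), 1))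
      ?_ ?_ ?_ ?_ ?_
    · simp
    · rw [mon_le _ (by simp)]
      simp [mon_pos, gB, nd_inj]
    · simp [bef_mon, gB, nd_lt, nd_val]
    · simp [gB, tB, mon_cons, mon_nil]
      try abel
    · rintro (⟨c', i'⟩ | ⟨c', i'⟩ | e')
      · fin_cases c' <;> simp [bef_mon, gB, tB, nd_inj, nd_lt, nd_val, Fin.ext_iff] <;> omega
      · fin_cases c' <;> simp [bef_mon, gB, tB, nd_inj, nd_lt, nd_val, Fin.ext_iff] <;> omega
      · fin_cases e' <;> simp [bef_mon, gB, tB, nd_inj, nd_lt, nd_val, Fin.ext_iff] <;> omega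
  · refine dual_aux hn _ (good_single (nd n (i.1 + 1) (by omega), 1) (nd n (i.1 + 1) (by omega), 0))
      ?_ ?_ ?_ ?_ ?_
    · simp
    · rw [mon_le _ (by simp)]
      simp [mon_pos, gB, nd_inj]
    · simp [bef_mon, gB, nd_lt, nd_val]
    · simp [gB, tB, mon_cons, mon_nil]
      try abel
    · rintro (⟨c', i'⟩ | ⟨c', i'⟩ | e')
      · fin_cases c' <;> simp [bef_mon, gB, tB, nd_inj, nd_lt, nd_val, Fin.ext_iff] <;> omega
      · fin_cases c' <;> simp [bef_mon, gB, tB, nd_inj, nd_lt, nd_val, Fin.ext_iff] <;> omega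
      · fin_cases e' <;> simp [bef_mon, gB, tB, nd_inj, nd_lt, nd_val, Fin.ext_iff] <;> omega
  · refine dual_aux hn _ (good_nbef (nd n i.1 (by omega)) 0)
      ?_ ?_ ?_ ?_ ?_
    · simp
    · rw [mon_le _ (by simp)]
      simp [mon_pos, gB, nd_inj]
    · simp [bef_mon, gB, nd_lt, nd_val]
    · simp [gB, tB, mon_cons, mon_nil]
      try abel
    · rintro (⟨c', i'⟩ | ⟨c', i'⟩ | e')
      · fin_cases c' <;> simp [bef_mon, gB, tB, nd_inj, nd_lt, nd_val, Fin.ext_iff] <;> omega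
      · fin_cases c' <;> simp [bef_mon, gB, tB, nd_inj, nd_lt, nd_val, Fin.ext_iff] <;> omega
      · fin_cases e' <;> simp [bef_mon, gB, tB, nd_inj, nd_lt, nd_val, Fin.ext_iff] <;> omega
  · refine dual_aux hn _ (good_bef (nd n (i.1 + 1) (by omega)) 1)
      ?_ ?_ ?_ ?_ ?_
    · simp
    · rw [mon_le _ (by simp)]
      simp [mon_pos, gB, nd_inj]
    · simp [bef_mon, gB, nd_lt, nd_val]
    · simp [gB, tB, mon_cons, mon_nil]
      try abel
    · rintro (⟨c', i'⟩ | ⟨c', i'⟩ | e')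
      · fin_cases c' <;> simp [bef_mon, gB, tB, nd_inj, nd_lt, nd_val, Fin.ext_iff] <;> omega
      · fin_cases c' <;> simp [bef_mon, gB, tB, nd_inj, nd_lt, nd_val, Fin.ext_iff] <;> omega
      · fin_cases e' <;> simp [bef_mon, gB, tB, nd_inj, nd_lt, nd_val, Fin.ext_iff] <;> omega
  · refine dual_aux hn _ (good_D1 (nd n i.1 (by omega)) (nd n (i.1 + 1) (by omega)) rfl)
      ?_ ?_ ?_ ?_ ?_
    · simp
    · rw [mon_le _ (by simp)]
      simp [mon_pos, gB, nd_inj]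
    · simp [bef_mon, gB, nd_lt, nd_val]
    · simp [gB, tB, mon_cons, mon_nil]
      try abel
    · rintro (⟨c', i'⟩ | ⟨c', i'⟩ | e')
      · fin_cases c' <;> simp [bef_mon, gB, tB, nd_inj, nd_lt, nd_val, Fin.ext_iff] <;> omega
      · fin_cases c' <;> simp [bef_mon, gB, tB, nd_inj, nd_lt, nd_val, Fin.ext_iff] <;> omega
      · fin_cases e' <;> simp [bef_mon, gB, tB, nd_inj, nd_lt, nd_val, Fin.ext_iff] <;> omega

set_option maxHeartbeats 2000000 in
theorem dual_triple (hn : 3 ≤ n) (d : Fin 6 × Fin (n - 2)) :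
    ∃ φ ∈ HilbTangentSpace K n, ∀ b', cf (mon (gB hn b')) (mon (tB hn b')) φ =
      if b' = .inr (.inl d) then 1 else 0 := by
  obtain ⟨c, i⟩ := d
  fin_cases c
  · refine dual_aux hn _ (good_single (nd n (i.1 + 1) (by omega), 2) (nd n (i.1 + 1) (by omega), 0))
      ?_ ?_ ?_ ?_ ?_
    · simp
    · rw [mon_le _ (by simp)]
      simp [mon_pos, gB, nd_inj]
    · simp [bef_mon, gB, nd_lt, nd_val]
    · simp [gB, tB, mon_cons, mon_nil]
      try abel
    · rintro (⟨c', i'⟩ | ⟨c', i'⟩ | e')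
      · fin_cases c' <;> simp [bef_mon, gB, tB, nd_inj, nd_lt, nd_val, Fin.ext_iff] <;> omega
      · fin_cases c' <;> simp [bef_mon, gB, tB, nd_inj, nd_lt, nd_val, Fin.ext_iff] <;> omega
      · fin_cases e' <;> simp [bef_mon, gB, tB, nd_inj, nd_lt, nd_val, Fin.ext_iff] <;> omega
  · refine dual_aux hn _ (good_D2' (nd n (i.1 + 1) (by omega)) (nd n (i.1 + 2) (by omega)) rfl)
      ?_ ?_ ?_ ?_ ?_
    · simp
    · rw [mon_le _ (by simp)]
      simp [mon_pos, gB, nd_inj]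
    · simp [bef_mon, gB, nd_lt, nd_val]
    · simp [gB, tB, mon_cons, mon_nil]
      try abel
    · rintro (⟨c', i'⟩ | ⟨c', i'⟩ | e')
      · fin_cases c' <;> simp [bef_mon, gB, tB, nd_inj, nd_lt, nd_val, Fin.ext_iff] <;> omega
      · fin_cases c' <;> simp [bef_mon, gB, tB, nd_inj, nd_lt, nd_val, Fin.ext_iff] <;> omega
      · fin_cases e' <;> simp [bef_mon, gB, tB, nd_inj, nd_lt, nd_val, Fin.ext_iff] <;> omega
  · refine dual_aux hn _ (good_bef (nd n (i.1 + 2) (by omega)) 0)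
      ?_ ?_ ?_ ?_ ?_
    · simp
    · rw [mon_le _ (by simp)]
      simp [mon_pos, gB, nd_inj]
    · simp [bef_mon, gB, nd_lt, nd_val]
    · simp [gB, tB, mon_cons, mon_nil]
      try abel
    · rintro (⟨c', i'⟩ | ⟨c', i'⟩ | e')
      · fin_cases c' <;> simp [bef_mon, gB, tB, nd_inj, nd_lt, nd_val, Fin.ext_iff] <;> omega
      · fin_cases c' <;> simp [bef_mon, gB, tB, nd_inj, nd_lt, nd_val, Fin.ext_iff] <;> omega
      · fin_cases e' <;> simp [bef_mon, gB, tB, nd_inj, nd_lt, nd_val, Fin.ext_iff] <;> omega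
  · refine dual_aux hn _ (good_single (nd n (i.1 + 1) (by omega), 2) (nd n (i.1 + 1) (by omega), 1))
      ?_ ?_ ?_ ?_ ?_
    · simp
    · rw [mon_le _ (by simp)]
      simp [mon_pos, gB, nd_inj]
    · simp [bef_mon, gB, nd_lt, nd_val]
    · simp [gB, tB, mon_cons, mon_nil]
      try abel
    · rintro (⟨c', i'⟩ | ⟨c', i'⟩ | e')
      · fin_cases c' <;> simp [bef_mon, gB, tB, nd_inj, nd_lt, nd_val, Fin.ext_iff] <;> omega
      · fin_cases c' <;> simp [bef_mon, gB, tB, nd_inj, nd_lt, nd_val, Fin.ext_iff] <;> omega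
      · fin_cases e' <;> simp [bef_mon, gB, tB, nd_inj, nd_lt, nd_val, Fin.ext_iff] <;> omega
  · refine dual_aux hn _ (good_D2 (nd n i.1 (by omega)) (nd n (i.1 + 1) (by omega)) rfl)
      ?_ ?_ ?_ ?_ ?_
    · simp
    · rw [mon_le _ (by simp)]
      simp [mon_pos, gB, nd_inj]
    · simp [bef_mon, gB, nd_lt, nd_val]
    · simp [gB, tB, mon_cons, mon_nil]
      try abel
    · rintro (⟨c', i'⟩ | ⟨c', i'⟩ | e')
      · fin_cases c' <;> simp [bef_mon, gB, tB, nd_inj, nd_lt, nd_val, Fin.ext_iff] <;> omega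
      · fin_cases c' <;> simp [bef_mon, gB, tB, nd_inj, nd_lt, nd_val, Fin.ext_iff] <;> omega
      · fin_cases e' <;> simp [bef_mon, gB, tB, nd_inj, nd_lt, nd_val, Fin.ext_iff] <;> omega
  · refine dual_aux hn _ (good_nbef (nd n i.1 (by omega)) 1)
      ?_ ?_ ?_ ?_ ?_
    · simp
    · rw [mon_le _ (by simp)]
      simp [mon_pos, gB, nd_inj]
    · simp [bef_mon, gB, nd_lt, nd_val]
    · simp [gB, tB, mon_cons, mon_nil]
      try abel
    · rintro (⟨c', i'⟩ | ⟨c', i'⟩ | e')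
      · fin_cases c' <;> simp [bef_mon, gB, tB, nd_inj, nd_lt, nd_val, Fin.ext_iff] <;> omega
      · fin_cases c' <;> simp [bef_mon, gB, tB, nd_inj, nd_lt, nd_val, Fin.ext_iff] <;> omega
      · fin_cases e' <;> simp [bef_mon, gB, tB, nd_inj, nd_lt, nd_val, Fin.ext_iff] <;> omega

set_option maxHeartbeats 2000000 in
theorem dual_ends (hn : 3 ≤ n) (d : Fin 2) :
    ∃ φ ∈ HilbTangentSpace K n, ∀ b', cf (mon (gB hn b')) (mon (tB hn b')) φ =
      if b' = .inr (.inr d) then 1 else 0 := by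
  fin_cases d
  · refine dual_aux hn _ (good_D3 (nd n 0 (by omega)) (nd n 1 (by omega)) rfl rfl)
      ?_ ?_ ?_ ?_ ?_
    · simp
    · rw [mon_le _ (by simp)]
      simp [mon_pos, gB, nd_inj]
    · simp [bef_mon, gB, nd_lt, nd_val]
    · simp [gB, tB, mon_cons, mon_nil]
      try abel
    · rintro (⟨c', i'⟩ | ⟨c', i'⟩ | e')
      · fin_cases c' <;> simp [bef_mon, gB, tB, nd_inj, nd_lt, nd_val, Fin.ext_iff] <;> omega
      · fin_cases c' <;> simp [bef_mon, gB, tB, nd_inj, nd_lt, nd_val, Fin.ext_iff] <;> omega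
      · fin_cases e' <;> simp [bef_mon, gB, tB, nd_inj, nd_lt, nd_val, Fin.ext_iff] <;> omega
  · refine dual_aux hn _ (good_D3' (nd n (n - 2) (by omega)) (nd n (n - 1) (by omega)) (by rw [nd_val]; omega) (by rw [nd_val]; omega))
      ?_ ?_ ?_ ?_ ?_
    · simp
    · rw [mon_le _ (by simp)]
      simp [mon_pos, gB, nd_inj]
    · simp [bef_mon, gB, nd_lt, nd_val]
    · simp [gB, tB, mon_cons, mon_nil]
      try abel
    · rintro (⟨c', i'⟩ | ⟨c', i'⟩ | e')
      · fin_cases c' <;> simp [bef_mon, gB, tB, nd_inj, nd_lt, nd_val, Fin.ext_iff] <;> omega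
      · fin_cases c' <;> simp [bef_mon, gB, tB, nd_inj, nd_lt, nd_val, Fin.ext_iff] <;> omega
      · fin_cases e' <;> simp [bef_mon, gB, tB, nd_inj, nd_lt, nd_val, Fin.ext_iff] <;> omega

theorem dual (hn : 3 ≤ n) (b : IB n) :
    ∃ φ ∈ HilbTangentSpace K n, ∀ b', cf (mon (gB hn b')) (mon (tB hn b')) φ =
      if b' = b then 1 else 0 := by
  rcases b with d | d | d
  · exact dual_pair hn d
  · exact dual_triple hn d
  · exact dual_ends hn d

theorem van_of (hn : 3 ≤ n) {φ : (Nideal K n) →ₗ[R' K n] (R' K n ⧸ Nideal K n)}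
    (h : ∀ b, cf (mon (gB hn b)) (mon (tB hn b)) φ = 0) : Van φ := by
  have e2 : ∀ i k : Fin n, i.1 + 1 = k.1 → ∃ a : Fin (n - 1),
      i = nd n a.1 (by omega) ∧ k = nd n (a.1 + 1) (by omega) := fun i k h =>
    ⟨⟨i.1, by omega⟩, rfl, Fin.ext h.symm⟩
  have e3 : ∀ i j k : Fin n, i.1 + 1 = j.1 → i.1 + 2 = k.1 → ∃ a : Fin (n - 2),
      i = nd n a.1 (by omega) ∧ j = nd n (a.1 + 1) (by omega) ∧ k = nd n (a.1 + 2) (by omega) :=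
    fun i j k h h' => ⟨⟨i.1, by omega⟩, rfl, Fin.ext h.symm, Fin.ext h'.symm⟩
  have q0 : 0 < n := by omega
  have q1 : n - 1 < n := by omega
  have q2 : n - 2 < n := by omega
  have q3 : 1 < n := by omega
  constructor
  · intro i k hk
    obtain ⟨a, rfl, rfl⟩ := e2 i k hk
    exact h (.inl (0, a))
  · intro i k hk
    obtain ⟨a, rfl, rfl⟩ := e2 i k hk
    exact h (.inl (1, a))
  · intro i k hk
    obtain ⟨a, rfl, rfl⟩ := e2 i k hk
    exact h (.inl (2, a))
  · intro i k hk
    obtain ⟨a, rfl, rfl⟩ := e2 i k hk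
    exact h (.inl (3, a))
  · intro i k hk
    obtain ⟨a, rfl, rfl⟩ := e2 i k hk
    exact h (.inl (4, a))
  · intro i k hi hk
    have hi' : i = nd n 0 q0 := Fin.ext hi
    have hk' : k = nd n 1 q3 := Fin.ext hk
    rw [hi', hk']
    exact h (.inr (.inr 0))
  · intro i k hi hk
    have hi' : i = nd n (n - 2) q2 := Fin.ext (by rw [nd_val]; omega)
    have hk' : k = nd n (n - 1) q1 := Fin.ext (by rw [nd_val]; omega)
    rw [hi', hk']
    exact h (.inr (.inr 1))
  · intro i j k hj hk
    obtain ⟨a, rfl, rfl, rfl⟩ := e3 i j k hj hk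
    exact h (.inr (.inl (0, a)))
  · intro i j k hj hk
    obtain ⟨a, rfl, rfl, rfl⟩ := e3 i j k hj hk
    exact h (.inr (.inl (1, a)))
  · intro i j k hj hk
    obtain ⟨a, rfl, rfl, rfl⟩ := e3 i j k hj hk
    exact h (.inr (.inl (2, a)))
  · intro i j k hj hk
    obtain ⟨a, rfl, rfl, rfl⟩ := e3 i j k hj hk
    exact h (.inr (.inl (3, a)))
  · intro i j k hj hk
    obtain ⟨a, rfl, rfl, rfl⟩ := e3 i j k hj hk
    exact h (.inr (.inl (4, a)))
  · intro i j k hj hk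
    obtain ⟨a, rfl, rfl, rfl⟩ := e3 i j k hj hk
    exact h (.inr (.inl (5, a)))

theorem finrank_main (hn : 3 ≤ n) :
    Module.finrank K (HilbTangentSpace K n) = 11 * n - 15 := by
  classical
  let Ψ : HilbTangentSpace K n →ₗ[K] (IB n → K) :=
    LinearMap.pi fun b => (cf (mon (gB hn b)) (mon (tB hn b))) ∘ₗ (HilbTangentSpace K n).subtype
  have hΨ : ∀ φ b, Ψ φ b = cf (mon (gB hn b)) (mon (tB hn b)) φ.1 := fun _ _ => rfl
  have hinj : Function.Injective Ψ := by
    rw [injective_iff_map_eq_zero]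
    intro φ hφ
    apply Subtype.ext
    refine phi_zero φ.2 (van_of hn fun b => ?_) hn
    rw [← hΨ, hφ, Pi.zero_apply]
  have hsurj : Function.Surjective Ψ := by
    choose θ hθ hθ' using dual (K := K) hn
    intro f
    refine ⟨∑ b, f b • ⟨θ b, hθ b⟩, ?_⟩
    ext b'
    rw [map_sum, Finset.sum_apply, Finset.sum_eq_single b']
    · rw [map_smul, Pi.smul_apply, hΨ, hθ' b' b', if_pos rfl, smul_eq_mul, mul_one]
    · intro b _ hb
      rw [map_smul, Pi.smul_apply, hΨ, hθ' b b', if_neg (Ne.symm hb), smul_zero]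
    · intro h
      exact absurd (Finset.mem_univ _) h
  rw [(LinearEquiv.ofBijective Ψ ⟨hinj, hsurj⟩).finrank_eq, Module.finrank_fintype_fun_eq_card]
  simp only [Fintype.card_sum, Fintype.card_prod, Fintype.card_fin]
  omega

end helpers

/-- The tangent space of the Hilbert scheme `𝓗_n` at `N_n`, i.e. the space of
degree-zero homomorphisms `Hom(N_n, R/N_n)₀`, has `K`-dimension `11n - 15`. -/
theorem stmt15 (hn : 3 ≤ n) :
    Module.finrank K (HilbTangentSpace K n) = 11 * n - 15 := by
  exact finrank_main hn

end
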